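/- In an adhesive category, the diagonal δ : A → A₂ into the kernel pair of any morphism g : A → D arising as a pushout leg along a monomorphism is a monomorphism, and the kernel pair A₂ is the union of the subobjects δ : A → A₂ and m₂ : C₂ → A₂. -/

import Mathlib

open CategoryTheory CategoryTheory.Limits

/-- The union of two subobjects in an adhesive category: the map out of a pushout over the
intersection of two monomorphisms is a monomorphism. -/
lemma CategoryTheory.Adhesive.mono_of_isPullback_of_isPushout {𝒞 : Type u} [Category.{v} 𝒞]
    [Adhesive 𝒞] {P X Y Z U : 𝒞} {p : P ⟶ X} {q : P ⟶ Y} {x : X ⟶ Z} {y : Y ⟶ Z} [Mono x] [Mono y]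
    (h : IsPullback p q x y) {j : X ⟶ U} {k : Y ⟶ U} (h' : IsPushout p q j k)
    {u : U ⟶ Z} (hj : j ≫ u = x) (hk : k ≫ u = y) : Mono u := by
  have h'' : IsPushout (pullback.fst x y) (pullback.snd x y) j k :=
    h'.of_iso h.isoPullback (Iso.refl _) (Iso.refl _) (Iso.refl _)
      (by simp) (by simp) (by simp) (by simp)
  have : u = h''.isoPushout.hom ≫ pushout.desc x y pullback.condition := by
    apply h''.hom_ext
    · simpa [hj] using (pushout.inl_desc x y pullback.condition).symm
    · simpa [hk] using (pushout.inr_desc x y pullback.condition).symm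
  rw [this]
  infer_instance

/-- In an adhesive category, for a pushout of `f : C ⟶ B` along a monomorphism `m : C ⟶ A`
with legs `g : A ⟶ D` and `n : B ⟶ D`, the diagonal `δ : A ⟶ A₂` into the kernel pair of `g`
is a monomorphism, and `A₂` is the union of the subobjects `δ : A ⟶ A₂` and `m₂ : C₂ ⟶ A₂`:
any subobject of `A₂` through which both `δ` and `m₂` factor is all of `A₂`. -/
theorem adhesive_kernelPair_union {𝒞 : Type u} [Category.{v} 𝒞] [Adhesive 𝒞]
    {C A B D C₂ A₂ : 𝒞} (m : C ⟶ A) (f : C ⟶ B) [Mono m]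
    (g : A ⟶ D) (n : B ⟶ D) (H : IsPushout m f g n)
    (f₁ f₂ : C₂ ⟶ C) (hf : IsPullback f₁ f₂ f f)
    (g₁ g₂ : A₂ ⟶ A) (hg : IsPullback g₁ g₂ g g)
    (δ : A ⟶ A₂) (hδ₁ : δ ≫ g₁ = 𝟙 A) (hδ₂ : δ ≫ g₂ = 𝟙 A)
    (m₂ : C₂ ⟶ A₂) [Mono m₂] (hm₁ : m₂ ≫ g₁ = f₁ ≫ m) (hm₂ : m₂ ≫ g₂ = f₂ ≫ m) :
    Mono δ ∧
      ∀ (S : 𝒞) (s : S ⟶ A₂), Mono s → (∃ d : A ⟶ S, d ≫ s = δ) →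
        (∃ e : C₂ ⟶ S, e ≫ s = m₂) → IsIso s := by
  have : Mono δ := mono_of_mono_fac hδ₁
  refine ⟨this, fun S s _ ⟨d, hd⟩ ⟨e, he⟩ ↦ ?_⟩
  let i : C ⟶ C₂ := hf.lift (𝟙 C) (𝟙 C) rfl
  have hi₁ : i ≫ f₁ = 𝟙 C := hf.lift_fst _ _ _
  have hi₂ : i ≫ f₂ = 𝟙 C := hf.lift_snd _ _ _
  have hw : m ≫ δ = i ≫ m₂ := by
    apply hg.hom_ext <;> simp [hδ₁, hδ₂, hm₁, hm₂, reassoc_of% hi₁, reassoc_of% hi₂]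
  -- The intersection of `δ` and `m₂` is `C`.
  have hC : IsPullback m i δ m₂ := by
    refine ⟨⟨hw⟩, ⟨PullbackCone.IsLimit.mk _ (fun t ↦ t.snd ≫ f₁) (fun t ↦ ?_) (fun t ↦ ?_)
      (fun t l _ hl ↦ ?_)⟩⟩
    · rw [Category.assoc, ← hm₁, ← t.condition_assoc, hδ₁, Category.comp_id]
    · have ht : t.snd ≫ f₁ = t.snd ≫ f₂ := by
        rw [← cancel_mono m, Category.assoc, Category.assoc, ← hm₁, ← hm₂, ← t.condition_assoc,
          ← t.condition_assoc, hδ₁, hδ₂]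
      apply hf.hom_ext <;> simp [hi₁, hi₂, ht]
    · rw [← hl, Category.assoc, hi₁, Category.comp_id]
  let U := pushout m i
  have hU : IsPushout m i (pushout.inl m i) (pushout.inr m i) := .of_hasPushout m i
  let u : U ⟶ A₂ := hU.desc δ m₂ hw
  have hu₁ : pushout.inl m i ≫ u = δ := hU.inl_desc _ _ _
  have hu₂ : pushout.inr m i ≫ u = m₂ := hU.inr_desc _ _ _
  have : Mono u := Adhesive.mono_of_isPullback_of_isPushout hC hU hu₁ hu₂
  have hH : IsPullback m f g n := Adhesive.isPullback_of_isPushout_of_mono_left H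
  have back : IsPullback (pushout.inr m i) f₁ (u ≫ g₁) m := by
    have hinr : pushout.inr m i ≫ u ≫ g₁ = f₁ ≫ m := by rw [reassoc_of% hu₂, hm₁]
    have key (t : PullbackCone (u ≫ g₁) m) : (t.fst ≫ u ≫ g₂) ≫ g = (t.snd ≫ f) ≫ n := by
      simp only [Category.assoc, ← hg.w, ← H.w]
      simpa using t.condition =≫ g
    let b (t : PullbackCone (u ≫ g₁) m) := hH.lift (t.fst ≫ u ≫ g₂) (t.snd ≫ f) (key t)
    have hb₁ (t) : b t ≫ m = t.fst ≫ u ≫ g₂ := hH.lift_fst _ _ _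
    have hb₂ (t) : b t ≫ f = t.snd ≫ f := hH.lift_snd _ _ _
    refine ⟨⟨hinr⟩, ⟨PullbackCone.IsLimit.mk _ (fun t ↦ hf.lift t.snd (b t) (hb₂ t).symm)
      (fun t ↦ ?_) (fun t ↦ hf.lift_fst _ _ _) (fun t l hl hl' ↦ ?_)⟩⟩
    · rw [← cancel_mono u, Category.assoc, hu₂]
      apply hg.hom_ext
      · simpa [hm₁] using t.condition.symm
      · simp [hm₂, hb₁]
    · apply hf.hom_ext
      · rw [hl', hf.lift_fst]
      · rw [hf.lift_snd, ← cancel_mono m, hb₁, ← hl, Category.assoc, Category.assoc,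
          reassoc_of% hu₂, hm₂]
  have top : IsPushout (pushout.inr m i) f₂ (u ≫ g₂) m := by
    refine IsPushout.of_top (h₁₁ := m) (v₁₁ := i) (v₁₂ := pushout.inl m i) ?_
      (by rw [reassoc_of% hu₂, hm₂]) hU
    rw [hi₂, reassoc_of% hu₁, hδ₂]
    exact IsPushout.of_vert_isIso ⟨by simp⟩
  -- The cube over the given pushout whose top face is `top` has pullback front faces.
  have front : IsPullback (u ≫ g₂) (u ≫ g₁) g g :=
    ((Adhesive.van_kampen H _ _ _ _ f₁ (u ≫ g₁) f g back hf.flip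
      ⟨by simp [hg.w]⟩ H.toCommSq.flip.flip top.toCommSq).1 top).1
  have hiso : u = (front.flip.isoIsPullback _ _ hg).hom := by
    apply hg.hom_ext <;> simp
  have : IsIso u := hiso ▸ inferInstance
  have hs : hU.desc d e (by rw [← cancel_mono s]; simp [hd, he, hw]) ≫ s = u := by
    apply hU.hom_ext <;> simp [hd, he, hu₁, hu₂]
  have : IsSplitEpi s := ⟨⟨⟨inv u ≫ hU.desc d e _, by rw [Category.assoc, hs, IsIso.inv_hom_id]⟩⟩⟩
  exact isIso_of_mono_of_isSplitEpi s
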